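/- Let B be a finite Lie-closed set of n-qubit Pauli strings with at least two elements, such that any two distinct elements of B are 𝔤-connected with respect to B (the anticommutation graph on B is connected). Suppose B is partitioned into r nonempty blocks C_1, …, C_r such that for every pair of blocks (C_a, C_b), including a = b, either every element of C_a commutes with every element of C_b, or every element of C_a anticommutes with every element of C_b. Then r ≥ 3. -/

import Mathlib

open Matrix

noncomputable section

/-- The four single-qubit Pauli matrices: I, X, Y, Z. -/
def pauli1 : Fin 4 → Matrix (Fin 2) (Fin 2) ℂ :=
  ![1, !![0, 1; 1, 0], !![0, -Complex.I; Complex.I, 0], !![1, 0; 0, -1]]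

/-- The `n`-qubit Pauli string determined by `f : Fin n → Fin 4`. -/
def PauliString (n : ℕ) (f : Fin n → Fin 4) :
    Matrix (Fin n → Fin 2) (Fin n → Fin 2) ℂ :=
  fun x y => ∏ i, pauli1 (f i) (x i) (y i)

/-- Two matrices commute. -/
def MComm {n : ℕ} (A B : Matrix (Fin n → Fin 2) (Fin n → Fin 2) ℂ) : Prop :=
  A * B = B * A

/-- Two matrices anticommute. -/
def MAntiComm {n : ℕ} (A B : Matrix (Fin n → Fin 2) (Fin n → Fin 2) ℂ) : Prop :=
  A * B = -(B * A)

/-- A matrix is an `n`-qubit Pauli string. -/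
def IsPauli {n : ℕ} (A : Matrix (Fin n → Fin 2) (Fin n → Fin 2) ℂ) : Prop :=
  ∃ f : Fin n → Fin 4, A = PauliString n f

/-- A set of `n`-qubit Pauli strings is Lie-closed: whenever two of its members
anticommute, the (unique) Pauli string appearing, up to a unit scalar, in their
product also belongs to the set. -/
def LieClosed {n : ℕ} (𝒢 : Set (Matrix (Fin n → Fin 2) (Fin n → Fin 2) ℂ)) : Prop :=
  ∀ P ∈ 𝒢, ∀ Q ∈ 𝒢, MAntiComm P Q →
    ∀ (c : ℂ) (R : Matrix (Fin n → Fin 2) (Fin n → Fin 2) ℂ),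
      ‖c‖ = 1 → IsPauli R → P * Q = c • R → R ∈ 𝒢

/-- `P` and `Q` are `𝔤`-connected with respect to `𝒢`: they are distinct and
joined by a chain of anticommutations passing through elements of `𝒢`
(the empty chain meaning that `P` and `Q` themselves anticommute). -/
def GConnected {n : ℕ} (𝒢 : Set (Matrix (Fin n → Fin 2) (Fin n → Fin 2) ℂ))
    (P Q : Matrix (Fin n → Fin 2) (Fin n → Fin 2) ℂ) : Prop :=
  P ≠ Q ∧ ∃ l : List (Matrix (Fin n → Fin 2) (Fin n → Fin 2) ℂ),
    (∀ R ∈ l, R ∈ 𝒢) ∧ List.Chain' MAntiComm (P :: (l ++ [Q]))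

theorem pauli1_mul_self (i : Fin 4) : pauli1 i * pauli1 i = 1 := by
  fin_cases i <;> ext a b <;> fin_cases a <;> fin_cases b <;>
    simp [pauli1, Matrix.mul_apply, Fin.sum_univ_two]

theorem exists_pauli1_mul (i j : Fin 4) :
    ∃ (c : ℂ) (k : Fin 4), ‖c‖ = 1 ∧ pauli1 i * pauli1 j = c • pauli1 k := by
  refine ⟨(![![1, 1, 1, 1], ![1, 1, Complex.I, -Complex.I], ![1, -Complex.I, 1, Complex.I],
      ![1, Complex.I, -Complex.I, 1]] : Fin 4 → Fin 4 → ℂ) i j,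
    (![![0, 1, 2, 3], ![1, 0, 3, 2], ![2, 3, 0, 1], ![3, 2, 1, 0]] : Fin 4 → Fin 4 → Fin 4) i j,
    ?_, ?_⟩
  · fin_cases i <;> fin_cases j <;> simp
  · fin_cases i <;> fin_cases j <;> ext a b <;> fin_cases a <;> fin_cases b <;>
      simp [pauli1, Matrix.mul_apply, Fin.sum_univ_two]

theorem PauliString_mul_apply {n : ℕ} (f g : Fin n → Fin 4) (x y : Fin n → Fin 2) :
    (PauliString n f * PauliString n g) x y =
      ∏ i, (pauli1 (f i) * pauli1 (g i)) (x i) (y i) := by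
  simp only [Matrix.mul_apply, PauliString, ← Finset.prod_mul_distrib]
  rw [Finset.prod_univ_sum, Fintype.piFinset_univ]

theorem PauliString_mul_self {n : ℕ} (f : Fin n → Fin 4) :
    PauliString n f * PauliString n f = 1 := by
  ext x y
  rw [PauliString_mul_apply]
  simp only [pauli1_mul_self, Matrix.one_apply, Fintype.prod_boole, funext_iff]
  congr

theorem exists_PauliString_mul {n : ℕ} (f g : Fin n → Fin 4) :
    ∃ (c : ℂ) (k : Fin n → Fin 4),
      ‖c‖ = 1 ∧ PauliString n f * PauliString n g = c • PauliString n k := by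
  choose c k hc hk using fun i => exists_pauli1_mul (f i) (g i)
  refine ⟨∏ i, c i, k, by simp [hc], ?_⟩
  ext x y
  rw [PauliString_mul_apply]
  simp [hk, PauliString, Finset.prod_mul_distrib]

theorem IsPauli.mul_self {n : ℕ} {A : Matrix (Fin n → Fin 2) (Fin n → Fin 2) ℂ}
    (hA : IsPauli A) : A * A = 1 := by
  obtain ⟨f, rfl⟩ := hA
  exact PauliString_mul_self f

theorem IsPauli.not_mComm_of_mAntiComm {n : ℕ}
    {A B : Matrix (Fin n → Fin 2) (Fin n → Fin 2) ℂ}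
    (hA : IsPauli A) (hB : IsPauli B) (h : MAntiComm A B) : ¬ MComm A B := by
  intro hc
  have h0 : A * B = 0 := by
    ext x y
    exact self_eq_neg.mp (congrFun₂ (h.trans (congrArg _ hc.symm)) x y)
  have h1 : (1 : Matrix (Fin n → Fin 2) (Fin n → Fin 2) ℂ) = 0 := by
    calc 1 = A * (A * B) * B := by rw [← mul_assoc, hA.mul_self, one_mul, hB.mul_self]
      _ = 0 := by rw [h0, mul_zero, zero_mul]
  exact one_ne_zero h1

/-- The Pauli string proportional to the product of an anticommuting pair anticommutes
with both factors. -/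
theorem MAntiComm.of_mul_eq_smul {n : ℕ}
    {P Q R : Matrix (Fin n → Fin 2) (Fin n → Fin 2) ℂ} (h : MAntiComm P Q)
    {c : ℂ} (hc : c ≠ 0) (hR : P * Q = c • R) : MAntiComm P R ∧ MAntiComm Q R := by
  obtain rfl : R = c⁻¹ • (P * Q) := by rw [hR, inv_smul_smul₀ hc]
  unfold MAntiComm at h ⊢
  constructor
  · rw [mul_smul_comm, smul_mul_assoc, mul_assoc P Q P, ← smul_neg, ← mul_neg, h]
  · rw [mul_smul_comm, smul_mul_assoc, ← smul_neg, ← mul_assoc, ← neg_mul, h, neg_neg]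

/-- **Lemma 13.** If a finite Lie-closed set `B` of Pauli strings
with at least two elements is connected in the anticommutation graph, and `B` is
partitioned into `r` nonempty blocks whose pairwise (anti)commutation relations
are uniform (including within each block), then `r ≥ 3`. -/
theorem blocks_ge_three
    {n : ℕ} (hn : 1 ≤ n)
    (B : Finset (Matrix (Fin n → Fin 2) (Fin n → Fin 2) ℂ))
    (hpauli : ∀ A ∈ B, IsPauli A)
    (hcard : 2 ≤ B.card)
    (hlie : LieClosed (B : Set (Matrix (Fin n → Fin 2) (Fin n → Fin 2) ℂ)))
    (hconn : ∀ P ∈ B, ∀ Q ∈ B, P ≠ Q →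
      GConnected (B : Set (Matrix (Fin n → Fin 2) (Fin n → Fin 2) ℂ)) P Q)
    (r : ℕ) (C : Fin r → Finset (Matrix (Fin n → Fin 2) (Fin n → Fin 2) ℂ))
    (hne : ∀ a, (C a).Nonempty)
    (hsub : ∀ a, C a ⊆ B)
    (hdisj : ∀ a b, a ≠ b → Disjoint (C a) (C b))
    (hcover : ∀ P ∈ B, ∃ a, P ∈ C a)
    (hblocks : ∀ a b, (∀ P ∈ C a, ∀ Q ∈ C b, MComm P Q) ∨
        (∀ P ∈ C a, ∀ Q ∈ C b, MAntiComm P Q)) :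
    3 ≤ r := by
  have hanti : ∃ P ∈ B, ∃ Q ∈ B, MAntiComm P Q := by
    obtain ⟨P, hP, Q, hQ, hPQ⟩ := Finset.one_lt_card.mp hcard
    obtain ⟨-, l, hl, hchain⟩ := hconn P hP Q hQ hPQ
    cases l with
    | nil => exact ⟨P, hP, Q, hQ, (List.isChain_cons_cons.mp hchain).1⟩
    | cons R l => exact ⟨P, hP, R, hl R (by simp), (List.isChain_cons_cons.mp hchain).1⟩
  obtain ⟨P, hP, Q, hQ, hPQ⟩ := hanti
  have hex : ∃ (c : ℂ) (R : Matrix (Fin n → Fin 2) (Fin n → Fin 2) ℂ),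
      ‖c‖ = 1 ∧ IsPauli R ∧ P * Q = c • R := by
    obtain ⟨f, rfl⟩ := hpauli P hP
    obtain ⟨g, rfl⟩ := hpauli Q hQ
    obtain ⟨c, k, hc, hk⟩ := exists_PauliString_mul f g
    exact ⟨c, _, hc, ⟨k, rfl⟩, hk⟩
  obtain ⟨c, R, hc, hRp, hPQR⟩ := hex
  have hR : R ∈ B := hlie P hP Q hQ hPQ c R hc hRp hPQR
  have hc0 : c ≠ 0 := by
    rintro rfl
    simp at hc
  obtain ⟨hPR, hQR⟩ := hPQ.of_mul_eq_smul hc0 hPQR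
  have hcomm : ∀ a, ∀ S ∈ C a, ∀ T ∈ C a, MComm S T := by
    intro a
    refine (hblocks a a).resolve_right fun h => ?_
    obtain ⟨S, hS⟩ := hne a
    have hSp := hpauli S (hsub a hS)
    exact hSp.not_mComm_of_mAntiComm hSp (h S hS S hS) rfl
  have hdiff : ∀ {S T}, S ∈ B → T ∈ B → MAntiComm S T →
      ∀ {a b}, S ∈ C a → T ∈ C b → (a : ℕ) ≠ b := by
    intro S T hS hT h a b ha hb hab
    obtain rfl := Fin.ext hab
    exact (hpauli S hS).not_mComm_of_mAntiComm (hpauli T hT) h (hcomm a S ha T hb)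
  obtain ⟨p, hp⟩ := hcover P hP
  obtain ⟨q, hq⟩ := hcover Q hQ
  obtain ⟨s, hs⟩ := hcover R hR
  have h1 := hdiff hP hQ hPQ hp hq
  have h2 := hdiff hP hR hPR hp hs
  have h3 := hdiff hQ hR hQR hq hs
  omega
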